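/- arXiv:2411.08110 — 2 statements merged into one kernel-verified Lean document; each statement's English description precedes it below -/
import Mathlib

section
/- It is impossible to perfectly discriminate the four unitaries {1₂, √σ_x, √σ_y, √σ_z} with two parallel uses: for every two-copy parallel tester {T^a}_{a∈{0,x,y,z}} on (ℂ²)^{⊗4} (i.e., with d_{I₁}=d_{I₂}=d_{O₁}=d_{O₂}=2), the success probability (1/4)∑_a Tr(T^a (C^a ⊗ C^a)) is strictly less than 1, where C^a is the Choi matrix of the unitary U_a with U_0 = 1₂, U_x = √σ_x = (e^{iπ/4}/√2)[[1,i],[i,1]], U_y = √σ_y = (e^{iπ/4}/√2)[[1,−1],[1,1]], U_z = √σ_z = diag(1,i). -/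
open Matrix BigOperators ComplexOrder

noncomputable section

/-- A quantum state on a finite-dimensional system: a positive semidefinite matrix of trace one. -/
def IsState {n : Type*} [Fintype n] (ρ : Matrix n n ℂ) : Prop :=
  ρ.PosSemidef ∧ ρ.trace = 1

/-- A POVM: a finite family of positive semidefinite matrices summing to the identity. -/
def IsPOVM {n ι : Type*} [Fintype n] [DecidableEq n] [Fintype ι]
    (M : ι → Matrix n n ℂ) : Prop :=
  (∀ i, (M i).PosSemidef) ∧ ∑ i, M i = (1 : Matrix n n ℂ)

/-- The link product `X * Y = Tr_E[(X^{T_E} ⊗ 1_B)(1_A ⊗ Y)]`, written out entrywise. -/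
def linkE {A E B : Type*} [Fintype E]
    (X : Matrix (A × E) (A × E) ℂ) (Y : Matrix (E × B) (E × B) ℂ) :
    Matrix (A × B) (A × B) ℂ :=
  Matrix.of fun p q => ∑ e : E, ∑ f : E, X (p.1, f) (q.1, e) * Y (f, p.2) (e, q.2)

/-- The identity and the principal square roots of the three Pauli matrices. -/
def sqrtPauli : Fin 4 → Matrix (Fin 2) (Fin 2) ℂ := fun a =>
  if a = 0 then 1
  else if a = 1 then
    (Complex.exp ((Real.pi : ℂ) * Complex.I / 4) / (Real.sqrt 2 : ℂ)) •
      !![1, Complex.I; Complex.I, 1]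
  else if a = 2 then
    (Complex.exp ((Real.pi : ℂ) * Complex.I / 4) / (Real.sqrt 2 : ℂ)) •
      !![1, -1; 1, 1]
  else !![1, 0; 0, Complex.I]

/-- The Choi matrix `|U⟩⟩⟨⟨U|` of the unitary channel of `U`, with `|U⟩⟩ = ∑_l |l⟩ ⊗ U|l⟩`. -/
def choiU {d : ℕ} (U : Matrix (Fin d) (Fin d) ℂ) :
    Matrix (Fin d × Fin d) (Fin d × Fin d) ℂ :=
  Matrix.of fun p q => U p.2 p.1 * starRingEnd ℂ (U q.2 q.1)

/-- `C^a ⊗ C^a`, reordered onto the index `(I₁ × I₂) × (O₁ × O₂)` used by parallel testers. -/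
def choiPairPar (a : Fin 4) :
    Matrix ((Fin 2 × Fin 2) × (Fin 2 × Fin 2)) ((Fin 2 × Fin 2) × (Fin 2 × Fin 2)) ℂ :=
  Matrix.of fun p q =>
    choiU (sqrtPauli a) (p.1.1, p.2.1) (q.1.1, q.2.1) *
    choiU (sqrtPauli a) (p.1.2, p.2.2) (q.1.2, q.2.2)

open Kronecker

section General

variable {n ι : Type*} [Fintype n]

lemma trace_conjTranspose_mul_self_mul (B D : Matrix n n ℂ) :
    (Bᴴ * B * (Dᴴ * D)).trace = ((B * Dᴴ)ᴴ * (B * Dᴴ)).trace := by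
  rw [← Matrix.mul_assoc, Matrix.trace_mul_comm, conjTranspose_mul, conjTranspose_conjTranspose]
  simp only [Matrix.mul_assoc]

variable [DecidableEq n]

open MatrixOrder in
lemma Matrix.PosSemidef.exists_eq_conjTranspose_mul_self {A : Matrix n n ℂ} (hA : A.PosSemidef) :
    ∃ B : Matrix n n ℂ, A = Bᴴ * B :=
  CStarAlgebra.nonneg_iff_eq_star_mul_self.mp hA.nonneg

lemma Matrix.PosSemidef.trace_mul_nonneg {A C : Matrix n n ℂ} (hA : A.PosSemidef)
    (hC : C.PosSemidef) : 0 ≤ (A * C).trace := by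
  obtain ⟨B, rfl⟩ := hA.exists_eq_conjTranspose_mul_self
  obtain ⟨D, rfl⟩ := hC.exists_eq_conjTranspose_mul_self
  rw [trace_conjTranspose_mul_self_mul]
  exact (posSemidef_conjTranspose_mul_self _).trace_nonneg

lemma Matrix.PosSemidef.mul_eq_zero_of_trace_mul_eq_zero {A C : Matrix n n ℂ}
    (hA : A.PosSemidef) (hC : C.PosSemidef) (h : (A * C).trace = 0) : A * C = 0 := by
  obtain ⟨B, rfl⟩ := hA.exists_eq_conjTranspose_mul_self
  obtain ⟨D, rfl⟩ := hC.exists_eq_conjTranspose_mul_self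
  rw [trace_conjTranspose_mul_self_mul, trace_conjTranspose_mul_self_eq_zero_iff] at h
  rw [Matrix.mul_assoc, ← Matrix.mul_assoc B, h, Matrix.zero_mul, Matrix.mul_zero]

/-- States that a POVM discriminates perfectly have orthogonal supports. -/
lemma IsPOVM.mul_eq_zero_of_perfect [Fintype ι] [DecidableEq ι] {M σ : ι → Matrix n n ℂ}
    (hM : IsPOVM M) (hσ : ∀ i, IsState (σ i))
    (h : (Fintype.card ι : ℝ) ≤ (∑ i, (M i * σ i).trace).re) {i j : ι} (hij : i ≠ j) :
    σ i * σ j = 0 := by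
  have hsum (k : ι) : ∑ l, (M l * σ k).trace.re = 1 := by
    rw [← Complex.re_sum, ← trace_sum, ← Finset.sum_mul, hM.2, Matrix.one_mul, (hσ k).2,
      Complex.one_re]
  have hnn (l k : ι) : 0 ≤ (M l * σ k).trace := (hM.1 l).trace_mul_nonneg (hσ k).1
  have hnn' (l k : ι) : 0 ≤ (M l * σ k).trace.re := (Complex.nonneg_iff.mp (hnn l k)).1
  have hle (k : ι) : (M k * σ k).trace.re ≤ 1 :=
    hsum k ▸ Finset.single_le_sum (f := fun l => (M l * σ k).trace.re)
      (fun l _ => hnn' l k) (Finset.mem_univ k)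
  have hone (k : ι) : (M k * σ k).trace.re = 1 := by
    refine (Finset.sum_eq_sum_iff_of_le fun k _ => hle k).mp (le_antisymm ?_ ?_) k
      (Finset.mem_univ k)
    · exact Finset.sum_le_sum fun k _ => hle k
    · simpa [Complex.re_sum] using h
  have hzero {l k : ι} (hlk : l ≠ k) : M l * σ k = 0 := by
    refine (hM.1 l).mul_eq_zero_of_trace_mul_eq_zero (hσ k).1 ?_
    have h1 := hsum k
    rw [← Finset.add_sum_erase _ _ (Finset.mem_univ k), hone k, add_eq_left,
      Finset.sum_eq_zero_iff_of_nonneg fun l _ => hnn' l k] at h1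
    exact Complex.ext (h1 l (by simp [hlk])) (Complex.nonneg_iff.mp (hnn l k)).2.symm
  have hself : M i * σ i = σ i := by
    have h1 : ∑ l, M l * σ i = σ i := by rw [← Finset.sum_mul, hM.2, Matrix.one_mul]
    rwa [Fintype.sum_eq_single i fun l hl => hzero hl] at h1
  have hself' : σ i * M i = σ i := by
    simpa [conjTranspose_mul, (hσ i).1.isHermitian.eq, (hM.1 i).isHermitian.eq] using
      congrArg conjTranspose hself
  rw [← hself', Matrix.mul_assoc, hzero hij, Matrix.mul_zero]

end General

/-- The complex conjugate of `U ⊗ U` for the `a`-th unitary `U`. -/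
def conjPair (a : Fin 4) : Matrix (Fin 2 × Fin 2) (Fin 2 × Fin 2) ℂ :=
  (sqrtPauli a ⊗ₖ sqrtPauli a).map (starRingEnd ℂ)

/-- The swap of two qubits. -/
def qubitSwap : Matrix (Fin 2 × Fin 2) (Fin 2 × Fin 2) ℂ :=
  Matrix.of fun p q => if p = q.swap then 1 else 0

lemma sqrtPauli_phase :
    Complex.exp ((Real.pi : ℂ) * Complex.I / 4) / (Real.sqrt 2 : ℂ) = (1 + Complex.I) / 2 := by
  have h : (Real.pi : ℂ) * Complex.I / 4 = ((Real.pi / 4 : ℝ) : ℂ) * Complex.I := by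
    push_cast; ring
  have h2 : (Real.sqrt 2 : ℂ) ≠ 0 := by
    exact_mod_cast (Real.sqrt_pos.mpr two_pos).ne'
  rw [h, Complex.exp_mul_I, ← Complex.ofReal_cos, ← Complex.ofReal_sin, Real.cos_pi_div_four,
    Real.sin_pi_div_four, div_eq_iff h2]
  push_cast
  ring

lemma conjPair_zero : conjPair 0 = 1 := by
  simp [conjPair, sqrtPauli]

lemma conj_two : starRingEnd ℂ 2 = 2 := map_ofNat _ 2

lemma sqrtPauli_conjTranspose_mul_self (a : Fin 4) : (sqrtPauli a)ᴴ * sqrtPauli a = 1 := by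
  fin_cases a <;> ext i j <;> fin_cases i <;> fin_cases j <;>
    simp [sqrtPauli, sqrtPauli_phase, conj_two, Matrix.mul_apply, Fin.sum_univ_two] <;>
    ring_nf <;> simp <;> norm_num

lemma conjPair_conjTranspose_mul_self (a : Fin 4) : (conjPair a)ᴴ * conjPair a = 1 := by
  have h : (conjPair a)ᴴ = ((sqrtPauli a)ᴴ ⊗ₖ (sqrtPauli a)ᴴ).map (starRingEnd ℂ) := by
    rw [conjPair, ← conjTranspose_kronecker]; rfl
  rw [h, conjPair, ← Matrix.map_mul, ← mul_kronecker_mul,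
    sqrtPauli_conjTranspose_mul_self]
  simp

lemma qubitSwap_conjTranspose : qubitSwapᴴ = qubitSwap := by
  ext ⟨i, j⟩ ⟨k, l⟩
  simp [qubitSwap, Prod.ext_iff, and_comm, eq_comm]

lemma qubitSwap_mul_self : qubitSwap * qubitSwap = 1 := by
  ext ⟨i, j⟩ ⟨k, l⟩
  fin_cases i <;> fin_cases j <;> fin_cases k <;> fin_cases l <;>
    simp [qubitSwap, Matrix.mul_apply]

lemma conjPair_combination :
    Complex.I • (conjPair 1 + conjPair 2 + conjPair 3) +
      (Complex.I • (conjPair 1 + conjPair 2 + conjPair 3))ᴴ =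
    (2 : ℂ) • 1 + (1 - qubitSwap)ᴴ * (1 - qubitSwap) := by
  have h : (1 - qubitSwap)ᴴ * (1 - qubitSwap) = (2 : ℂ) • (1 - qubitSwap) := by
    rw [conjTranspose_sub, qubitSwap_conjTranspose, conjTranspose_one, sub_mul, mul_sub, mul_sub,
      qubitSwap_mul_self, two_smul, Matrix.one_mul, Matrix.one_mul, Matrix.mul_one]
    abel
  rw [h]
  ext ⟨i, j⟩ ⟨k, l⟩
  fin_cases i <;> fin_cases j <;> fin_cases k <;> fin_cases l <;>
    simp [conjPair, sqrtPauli, sqrtPauli_phase, qubitSwap, conj_two] <;>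
    ring_nf <;> simp <;> ring_nf

lemma eq_zero_of_mul_conjPair_mul_eq_zero {E : Type*} [Fintype E] [DecidableEq E]
    {ρ : Matrix ((Fin 2 × Fin 2) × E) ((Fin 2 × Fin 2) × E) ℂ} (hρ : ρ.IsHermitian)
    (h : ∀ a, a ≠ 0 → ρ * (conjPair a ⊗ₖ (1 : Matrix E E ℂ)) * ρ = 0) : ρ = 0 := by
  set A := Complex.I • (conjPair 1 + conjPair 2 + conjPair 3) with hA
  have h1 : ρ * (A ⊗ₖ (1 : Matrix E E ℂ)) * ρ = 0 := by
    simp [hA, smul_kronecker, add_kronecker, Matrix.mul_add, Matrix.add_mul, h]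
  have h2 : ρ * (Aᴴ ⊗ₖ (1 : Matrix E E ℂ)) * ρ = 0 := by
    simpa [conjTranspose_mul, conjTranspose_kronecker, hρ.eq, Matrix.mul_assoc] using
      congrArg conjTranspose h1
  have h3 : ρ * ((A + Aᴴ) ⊗ₖ (1 : Matrix E E ℂ)) * ρ = 0 := by
    rw [add_kronecker, Matrix.mul_add, Matrix.add_mul, h1, h2, add_zero]
  set N := ((1 - qubitSwap) ⊗ₖ (1 : Matrix E E ℂ)) * ρ with hN
  have h4 : (2 : ℂ) • (ρᴴ * ρ) + Nᴴ * N = 0 := by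
    rw [← h3, conjPair_combination, add_kronecker, smul_kronecker, one_kronecker_one, hN,
      conjTranspose_mul, conjTranspose_kronecker, hρ.eq, Matrix.mul_add, Matrix.add_mul,
      Matrix.mul_assoc, ← Matrix.mul_assoc _ _ ρ, ← mul_kronecker_mul]
    simp [Matrix.mul_assoc]
  have h5 := congrArg trace h4
  have h6 : 0 ≤ (ρᴴ * ρ).trace := (posSemidef_conjTranspose_mul_self ρ).trace_nonneg
  have h7 : 0 ≤ (Nᴴ * N).trace := (posSemidef_conjTranspose_mul_self N).trace_nonneg
  rw [trace_add, trace_smul, trace_zero, smul_eq_mul,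
    add_eq_zero_iff_of_nonneg (mul_nonneg zero_le_two h6) h7] at h5
  exact trace_conjTranspose_mul_self_eq_zero_iff.mp
    ((mul_eq_zero.mp h5.1).resolve_left two_ne_zero)

lemma choiPairPar_apply (a : Fin 4) (p q : (Fin 2 × Fin 2) × (Fin 2 × Fin 2)) :
    choiPairPar a p q = starRingEnd ℂ (conjPair a p.2 p.1) * conjPair a q.2 q.1 := by
  simp only [choiPairPar, choiU, conjPair, of_apply, map_apply, kroneckerMap_apply, map_mul,
    Complex.conj_conj]
  ring

lemma kronecker_one_mul_mul_conjTranspose_apply {A B E : Type*} [Fintype A] [Fintype E]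
    [DecidableEq E] (G : Matrix B A ℂ) (ρ : Matrix (A × E) (A × E) ℂ) (p q : B × E) :
    ((G ⊗ₖ (1 : Matrix E E ℂ)) * ρ * (G ⊗ₖ (1 : Matrix E E ℂ))ᴴ) p q =
      ∑ y, ∑ x, G p.1 x * ρ (x, p.2) (y, q.2) * starRingEnd ℂ (G q.1 y) := by
  simp [Matrix.mul_apply, Fintype.sum_prod_type, Matrix.one_apply, Finset.sum_mul, apply_ite]

/-- The outcome probability of a parallel tester, written with the output state on `B ⊗ E`. -/
lemma trace_linkE_mul_eq {A B E : Type*} [Fintype A] [Fintype B] [Fintype E] [DecidableEq E]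
    (G : Matrix B A ℂ) (ρ : Matrix (A × E) (A × E) ℂ) (M : Matrix (E × B) (E × B) ℂ)
    (C : Matrix (A × B) (A × B) ℂ)
    (hC : ∀ p q, C p q = starRingEnd ℂ (G p.2 p.1) * G q.2 q.1) :
    (linkE ρ Mᵀ * C).trace =
      (M.submatrix Prod.swap Prod.swap *
        ((G ⊗ₖ (1 : Matrix E E ℂ)) * ρ * (G ⊗ₖ (1 : Matrix E E ℂ))ᴴ)).trace := by
  simp only [trace, diag_apply, Matrix.mul_apply (N := C),
    Matrix.mul_apply (M := M.submatrix Prod.swap Prod.swap),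
    kronecker_one_mul_mul_conjTranspose_apply, linkE, of_apply, hC, transpose_apply,
    submatrix_apply, Finset.sum_mul, Finset.mul_sum, ← Finset.univ_product_univ,
    Finset.sum_product]
  simp only [Prod.swap, ← Fintype.sum_prod_type']
  refine Fintype.sum_equiv
    ⟨fun ⟨p₁, p₂, q₁, q₂, e, f⟩ => ⟨q₂, e, p₂, f, q₁, p₁⟩,
     fun ⟨q₂, e, p₂, f, q₁, p₁⟩ => ⟨p₁, p₂, q₁, q₂, e, f⟩,
     fun _ => rfl, fun _ => rfl⟩ _ _ fun _ => ?_
  simp only [Equiv.coe_fn_mk]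
  ring

/-- No two-copy parallel tester discriminates the four unitaries
`{1, √σ_x, √σ_y, √σ_z}` perfectly: the success probability is strictly less than `1`. -/
theorem no_perfect_parallel_discrimination_sqrt_pauli
    (T : Fin 4 → Matrix ((Fin 2 × Fin 2) × (Fin 2 × Fin 2))
                        ((Fin 2 × Fin 2) × (Fin 2 × Fin 2)) ℂ)
    (hT : ∃ (dE : ℕ), 1 ≤ dE ∧
      ∃ (ρ : Matrix ((Fin 2 × Fin 2) × Fin dE) ((Fin 2 × Fin 2) × Fin dE) ℂ)
        (M : Fin 4 → Matrix (Fin dE × (Fin 2 × Fin 2)) (Fin dE × (Fin 2 × Fin 2)) ℂ),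
        IsState ρ ∧ IsPOVM M ∧ ∀ a, T a = linkE ρ (M a)ᵀ) :
    (1 / 4 : ℝ) * (∑ a, Matrix.trace (T a * choiPairPar a)).re < 1 := by
  obtain ⟨dE, -, ρ, M, hρ, hM, hT⟩ := hT
  by_contra! hcon
  let L (a : Fin 4) := conjPair a ⊗ₖ (1 : Matrix (Fin dE) (Fin dE) ℂ)
  have hL0 : L 0 = 1 := by simp only [L, conjPair_zero, one_kronecker_one]
  have hL (a : Fin 4) : (L a)ᴴ * L a = 1 := by
    simp only [L, conjTranspose_kronecker, ← mul_kronecker_mul, conjPair_conjTranspose_mul_self,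
      conjTranspose_one, Matrix.mul_one, one_kronecker_one]
  have hσ (a : Fin 4) : IsState (L a * ρ * (L a)ᴴ) := by
    refine ⟨hρ.1.mul_mul_conjTranspose_same _, ?_⟩
    rw [Matrix.trace_mul_comm, ← Matrix.mul_assoc, hL, Matrix.one_mul, hρ.2]
  have hM' : IsPOVM fun a => (M a).submatrix Prod.swap Prod.swap := by
    refine ⟨fun a => (hM.1 a).submatrix _, ?_⟩
    rw [← Matrix.submatrix_one (α := ℂ) (Prod.swap : (Fin 2 × Fin 2) × Fin dE → _)
      Prod.swap_injective, ← hM.2]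
    ext p q
    simp [Matrix.sum_apply]
  have hsum : ∑ a, (T a * choiPairPar a).trace =
      ∑ a, ((M a).submatrix Prod.swap Prod.swap * (L a * ρ * (L a)ᴴ)).trace :=
    Finset.sum_congr rfl fun a _ => by
      rw [hT a, trace_linkE_mul_eq (conjPair a) ρ (M a) _ (choiPairPar_apply a)]
  have hperfect : (Fintype.card (Fin 4) : ℝ) ≤
      (∑ a, ((M a).submatrix Prod.swap Prod.swap * (L a * ρ * (L a)ᴴ)).trace).re := by
    rw [← hsum, Fintype.card_fin]
    push_cast
    linarith
  have hzero : ρ = 0 := by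
    refine eq_zero_of_mul_conjPair_mul_eq_zero hρ.1.isHermitian fun a ha => ?_
    have h := hM'.mul_eq_zero_of_perfect hσ hperfect ha.symm
    rw [hL0, conjTranspose_one, Matrix.one_mul, Matrix.mul_one] at h
    calc ρ * L a * ρ = ρ * (L a * ρ * (L a)ᴴ) * L a := by
          simp only [Matrix.mul_assoc, hL, Matrix.mul_one]
      _ = 0 := by rw [h, Matrix.zero_mul]
  simpa [hzero] using hρ.2
end
end

section
/- Let Φ_A: M_{d_A}(ℂ)→V_A and Ψ_B: M_{d_B}(ℂ)→V_B be linear maps into finite-dimensional complex vector spaces, and a∈V_A, b∈V_B. A state ρ_AB on ℂ^{d_A}⊗ℂ^{d_B} is constrained separable with respect to (Φ_A,Ψ_B,a,b) if and only if for every k ∈ ℕ there exists a state ρ_k on (ℂ^{d_A})^{⊗k}⊗ℂ^{d_B} satisfying: (1) Tr_{A^{k−1}}(ρ_k) = ρ_AB; (2) (U_σ ⊗ 1_B) ρ_k (U_σ† ⊗ 1_B) = ρ_k for every permutation σ of the k A-factors, where U_σ is the corresponding permutation unitary on (ℂ^{d_A})^{⊗k}; (3) (id_{A^k} ⊗ Ψ_B)(ρ_k)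 = Tr_B(ρ_k) ⊗ b; (4) (id_{A^{k−1}} ⊗ Φ_A)(Tr_B(ρ_k)) = Tr_{A B}(ρ_k) ⊗ a, where Tr_{AB} traces out one A-factor and B. -/
open Matrix BigOperators ComplexOrder

noncomputable section

/-- Constrained separability of a bipartite state with respect to the data
`(Φ_A, Ψ_B, a, b)`. -/
def ConstrainedSep {dA dB : ℕ} {VA VB : Type*}
    [AddCommGroup VA] [Module ℂ VA] [AddCommGroup VB] [Module ℂ VB]
    (ΦA : Matrix (Fin dA) (Fin dA) ℂ →ₗ[ℂ] VA)
    (ΨB : Matrix (Fin dB) (Fin dB) ℂ →ₗ[ℂ] VB)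
    (a : VA) (b : VB)
    (ρ : Matrix (Fin dA × Fin dB) (Fin dA × Fin dB) ℂ) : Prop :=
  ∃ (L : ℕ) (p : Fin L → ℝ)
    (ρA : Fin L → Matrix (Fin dA) (Fin dA) ℂ)
    (ρB : Fin L → Matrix (Fin dB) (Fin dB) ℂ),
    (∀ l, 0 ≤ p l) ∧ (∑ l, p l = 1) ∧
    (∀ l, IsState (ρA l) ∧ IsState (ρB l) ∧ ΦA (ρA l) = a ∧ ΨB (ρB l) = b) ∧
    ρ = ∑ l, (p l : ℂ) • Matrix.kroneckerMap (· * ·) (ρA l) (ρB l)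

/-- The partial trace over the first tensor factor. -/
def partialTraceLeft {A J : Type*} [Fintype A] (T : Matrix (A × J) (A × J) ℂ) : Matrix J J ℂ :=
  Matrix.of fun j j' => ∑ x, T (x, j) (x, j')

/-- The partial trace over the second tensor factor. -/
def partialTraceRight {A J : Type*} [Fintype J] (T : Matrix (A × J) (A × J) ℂ) : Matrix A A ℂ :=
  Matrix.of fun x x' => ∑ j, T (x, j) (x', j)

/-- The unnormalized state of the second factor after the first one is found along `v`. -/
def condLeft {A J : Type*} [Fintype A] (v : A → ℂ) (T : Matrix (A × J) (A × J) ℂ) :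
    Matrix J J ℂ :=
  Matrix.of fun j j' => ∑ x, ∑ x', star (v x) * T (x, j) (x', j') * v x'

lemma condLeft_posSemidef {A J : Type*} [Fintype A] [Fintype J] (v : A → ℂ)
    {T : Matrix (A × J) (A × J) ℂ} (hT : T.PosSemidef) : (condLeft v T).PosSemidef := by
  classical
  let V : Matrix (A × J) J ℂ := Matrix.of fun p j => if p.2 = j then v p.1 else 0
  have h : condLeft v T = Vᴴ * T * V := by
    ext j j'
    simp only [condLeft, V, Matrix.mul_apply, Matrix.of_apply, Matrix.conjTranspose_apply,
      Fintype.sum_prod_type, apply_ite star, star_zero, ite_mul, mul_ite, zero_mul, mul_zero,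
      Finset.sum_ite_eq', Finset.mem_univ, if_true, Finset.sum_mul]
    exact Finset.sum_comm
  rw [h]
  exact hT.conjTranspose_mul_mul_same V

lemma partialTraceLeft_posSemidef {A J : Type*} [Fintype A] [Fintype J]
    {T : Matrix (A × J) (A × J) ℂ} (hT : T.PosSemidef) : (partialTraceLeft T).PosSemidef := by
  have h : partialTraceLeft T = ∑ x, T.submatrix (fun j => (x, j)) (fun j => (x, j)) := by
    ext j j'
    simp [partialTraceLeft, Matrix.sum_apply]
  rw [h]
  exact Matrix.posSemidef_sum _ fun x _ => hT.submatrix _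

lemma partialTraceRight_posSemidef {A J : Type*} [Fintype A] [Fintype J]
    {T : Matrix (A × J) (A × J) ℂ} (hT : T.PosSemidef) : (partialTraceRight T).PosSemidef := by
  have h : partialTraceRight T = ∑ j, T.submatrix (fun x => (x, j)) (fun x => (x, j)) := by
    ext x x'
    simp [partialTraceRight, Matrix.sum_apply]
  rw [h]
  exact Matrix.posSemidef_sum _ fun x _ => hT.submatrix _

lemma trace_partialTraceLeft {A J : Type*} [Fintype A] [Fintype J]
    (T : Matrix (A × J) (A × J) ℂ) : (partialTraceLeft T).trace = T.trace := by
  simp only [Matrix.trace, partialTraceLeft, Matrix.diag_apply, Matrix.of_apply,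
    Fintype.sum_prod_type]
  exact Finset.sum_comm

lemma trace_partialTraceRight {A J : Type*} [Fintype A] [Fintype J]
    (T : Matrix (A × J) (A × J) ℂ) : (partialTraceRight T).trace = T.trace := by
  simp only [Matrix.trace, partialTraceRight, Matrix.diag_apply, Matrix.of_apply,
    Fintype.sum_prod_type]

lemma Matrix.PosSemidef.ofReal_re_trace {n : Type*} [Fintype n] {M : Matrix n n ℂ}
    (hM : M.PosSemidef) : ((M.trace.re : ℝ) : ℂ) = M.trace :=
  (Complex.eq_re_of_ofReal_le (r := 0) (by simpa using hM.trace_nonneg)).symm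

lemma Matrix.PosSemidef.re_trace_nonneg {n : Type*} [Fintype n] {M : Matrix n n ℂ}
    (hM : M.PosSemidef) : 0 ≤ M.trace.re :=
  (Complex.nonneg_iff.1 hM.trace_nonneg).1

lemma Matrix.PosSemidef.eq_zero_of_re_trace {n : Type*} [Fintype n] {M : Matrix n n ℂ}
    (hM : M.PosSemidef) (h : M.trace.re = 0) : M = 0 := by
  rw [← hM.trace_eq_zero_iff, ← hM.ofReal_re_trace, h, Complex.ofReal_zero]

lemma Matrix.PosSemidef.norm_apply_le_re_trace {n : Type*} [Fintype n] {M : Matrix n n ℂ}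
    (hM : M.PosSemidef) (i j : n) : ‖M i j‖ ≤ M.trace.re := by
  have hd : ∀ i, 0 ≤ (M i i).re ∧ (M i i).im = 0 := fun i =>
    ⟨(Complex.nonneg_iff.1 hM.diag_nonneg).1, (Complex.nonneg_iff.1 hM.diag_nonneg).2.symm⟩
  have hle : ∀ i, (M i i).re ≤ M.trace.re := fun i => by
    rw [Matrix.trace, Complex.re_sum]
    exact Finset.single_le_sum (f := fun i => (M i i).re) (fun i _ => (hd i).1)
      (Finset.mem_univ i)
  have hdet := (hM.submatrix ![i, j]).det_nonneg
  have hji : M j i = star (M i j) := (hM.isHermitian.apply j i).symm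
  rw [Matrix.det_fin_two] at hdet
  simp only [Matrix.submatrix_apply, Matrix.cons_val_zero, Matrix.cons_val_one, hji] at hdet
  have hre := (Complex.nonneg_iff.1 hdet).1
  rw [Complex.star_def, Complex.mul_conj, Complex.sub_re, Complex.mul_re, Complex.ofReal_re,
    (hd i).2, Complex.normSq_eq_norm_sq] at hre
  refine abs_le_of_sq_le_sq' ?_ hM.re_trace_nonneg |>.2
  nlinarith [hle i, hle j, (hd i).1, (hd j).1,
    mul_le_mul (hle i) (hle j) (hd j).1 hM.re_trace_nonneg]

/-- Vectors whose rank-one projectors resolve the identity and span the full matrix algebra,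
with coefficients `c` for the dual frame. -/
structure IsTomographic {A X : Type*} [Fintype X] [DecidableEq A] (v : X → A → ℂ)
    (c : A → A → X → ℂ) : Prop where
  resolution : ∀ y y', ∑ x, star (v x y) * v x y' = if y = y' then 1 else 0
  dual : ∀ i j y y', ∑ x, c i j x * (star (v x y) * v x y') = if y = i ∧ y' = j then 1 else 0

lemma exists_isTomographic (A : Type) [Fintype A] [DecidableEq A] [Nonempty A] :
    ∃ (X : Type) (_ : Fintype X) (v : X → A → ℂ) (c : A → A → X → ℂ), IsTomographic v c := by
  have hd : (0 : ℝ) < 8 * Fintype.card A := by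
    have := Fintype.card_pos (α := A)
    positivity
  set s : ℝ := √((8 * Fintype.card A)⁻¹)
  have hs : (s : ℂ) * s = (8 * (Fintype.card A : ℂ))⁻¹ := by
    rw [← Complex.ofReal_mul, Real.mul_self_sqrt (by positivity)]
    push_cast
    rfl
  have hd' : (Fintype.card A : ℂ) ≠ 0 := Nat.cast_ne_zero.2 Fintype.card_ne_zero
  let δ : A → A → ℂ := fun x y => if x = y then 1 else 0
  have hδ : ∀ x y, (starRingEnd ℂ) (δ x y) = δ x y := fun x y => by simp [δ, apply_ite]
  refine ⟨A × A × Fin 4, inferInstance,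
    fun x y => s * (δ y x.1 + Complex.I ^ (x.2.2 : ℕ) * δ y x.2.1),
    fun i j x => δ i x.1 * δ j x.2.1 * ((-Complex.I) ^ (x.2.2 : ℕ) * (2 * Fintype.card A)), ?_, ?_⟩
  · intro y y'
    have key : ∀ i j : A, ∑ t : Fin 4, star (s * (δ y i + Complex.I ^ (t : ℕ) * δ y j)) *
        (s * (δ y' i + Complex.I ^ (t : ℕ) * δ y' j)) =
        s * s * 4 * (δ y i * δ y' i + δ y j * δ y' j) := by
      intro i j
      simp only [Fin.sum_univ_four, Complex.star_def, map_mul, map_add, map_pow, hδ,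
        Complex.conj_I, Complex.conj_ofReal, Fin.val_zero, Fin.val_one, Fin.val_two,
        show ((3 : Fin 4) : ℕ) = 3 from rfl]
      ring_nf
      simp only [Complex.I_sq, show Complex.I ^ 3 = -Complex.I by simp [pow_succ],
        show Complex.I ^ 4 = 1 by simp [pow_succ], show Complex.I ^ 6 = -1 by simp [pow_succ]]
      ring
    have hsum : ∑ i, δ y i * δ y' i = if y = y' then 1 else 0 := by
      simp [δ]
    simp only [Fintype.sum_prod_type]
    simp only [key, ← Finset.mul_sum, Finset.sum_add_distrib, Finset.sum_const,
      hsum, Finset.card_univ, hs, nsmul_eq_mul]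
    simp only [mul_left_comm (δ _ _) (Fintype.card A : ℂ), ← Finset.mul_sum, hsum]
    field_simp
    ring
  · intro i j y y'
    have key : ∀ i' j' : A, ∑ t : Fin 4,
        δ i i' * δ j j' * ((-Complex.I) ^ (t : ℕ) * (2 * Fintype.card A)) *
        (star (s * (δ y i' + Complex.I ^ (t : ℕ) * δ y j')) *
        (s * (δ y' i' + Complex.I ^ (t : ℕ) * δ y' j'))) =
        δ i i' * δ j j' * (s * s * (8 * Fintype.card A)) * (δ y i' * δ y' j') := by
      intro i' j'
      simp only [Fin.sum_univ_four, Complex.star_def, map_mul, map_add, map_pow, hδ,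
        Complex.conj_I, Complex.conj_ofReal, Fin.val_zero, Fin.val_one, Fin.val_two,
        show ((3 : Fin 4) : ℕ) = 3 from rfl]
      ring_nf
      simp only [Complex.I_sq, show Complex.I ^ 3 = -Complex.I by simp [pow_succ],
        show Complex.I ^ 4 = 1 by simp [pow_succ], show Complex.I ^ 6 = -1 by simp [pow_succ],
        show Complex.I ^ 9 = Complex.I by simp [pow_succ]]
      ring
    simp only [Fintype.sum_prod_type]
    simp only [key, hs, inv_mul_cancel₀ (mul_ne_zero (by norm_num : (8 : ℂ) ≠ 0) hd')]
    simp only [δ, mul_ite, mul_one, mul_zero, Finset.sum_ite_eq,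
      Finset.mem_univ, if_true]
    by_cases h1 : y = i <;> by_cases h2 : y' = j <;> simp [@eq_comm _ i y, @eq_comm _ j y', h1, h2]

lemma IsTomographic.apply_eq_sum {A J X : Type*} [Fintype X] [Fintype A] [DecidableEq A]
    {v : X → A → ℂ} {c : A → A → X → ℂ} (hv : IsTomographic v c) (T : Matrix (A × J) (A × J) ℂ)
    (i i' : A) (j j' : J) :
    T (i, j) (i', j') = ∑ x, c i i' x * condLeft (v x) T j j' := by
  have h : ∀ x, c i i' x * condLeft (v x) T j j' =
      ∑ y, ∑ y', c i i' x * (star (v x y) * v x y') * T (y, j) (y', j') := fun x => by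
    simp only [condLeft, Matrix.of_apply, Finset.mul_sum]
    exact Finset.sum_congr rfl fun y _ => Finset.sum_congr rfl fun y' _ => by ring
  simp only [h]
  rw [Finset.sum_comm]
  simp_rw [Finset.sum_comm (s := (Finset.univ : Finset X)), ← Finset.sum_mul, hv.dual, ite_and]
  simp

lemma sum_norm_sub_le {X : Type*} [Fintype X] (z : X → ℂ) (p : X → ℝ) (hp : ∀ x, 0 ≤ p x)
    (hz : ∀ x, p x = 0 → z x = 0) {δ : ℝ} (hδ : 0 < δ) :
    ∑ x, ‖z x - ((p x * (∑ x, p x)⁻¹ : ℝ) : ℂ) * ∑ x, z x‖ ≤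
      δ * ∑ x, p x + δ⁻¹ * (∑ x, ‖z x‖ ^ 2 / p x - ‖∑ x, z x‖ ^ 2 / ∑ x, p x) := by
  set P := ∑ x, p x
  set w := ∑ x, z x with hw
  have hdiv : ∀ x, ‖z x - ((p x * P⁻¹ : ℝ) : ℂ) * w‖ ^ 2 / p x =
      ‖z x‖ ^ 2 / p x - 2 * P⁻¹ * (z x * star w).re + p x * (P⁻¹ * P⁻¹ * ‖w‖ ^ 2) := by
    intro x
    rcases (hp x).eq_or_lt' with h | h
    · simp [h, hz x h]
    · rw [← Complex.normSq_eq_norm_sq, Complex.normSq_sub, Complex.normSq_mul,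
        Complex.normSq_ofReal, ← Complex.normSq_eq_norm_sq, ← Complex.normSq_eq_norm_sq,
        map_mul, Complex.conj_ofReal, mul_left_comm (z x), Complex.re_ofReal_mul, Complex.star_def]
      field_simp
      ring
  have hle : ∀ x, ‖z x - ((p x * P⁻¹ : ℝ) : ℂ) * w‖ ≤
      δ * p x + δ⁻¹ * (‖z x - ((p x * P⁻¹ : ℝ) : ℂ) * w‖ ^ 2 / p x) := by
    intro x
    rcases (hp x).eq_or_lt' with h | h
    · simp [h, hz x h]
    · set D := ‖z x - ((p x * P⁻¹ : ℝ) : ℂ) * w‖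
      have h1 : δ * p x + δ⁻¹ * (D ^ 2 / p x) - D =
          ((δ * p x - D / 2) ^ 2 + 3 / 4 * D ^ 2) / (δ * p x) := by
        field_simp
        ring
      have h2 : 0 ≤ ((δ * p x - D / 2) ^ 2 + 3 / 4 * D ^ 2) / (δ * p x) := by positivity
      linarith
  have hww : ∑ x, (z x * star w).re = ‖w‖ ^ 2 := by
    rw [← Complex.re_sum, ← Finset.sum_mul, ← hw, Complex.star_def, Complex.mul_conj,
      Complex.ofReal_re, Complex.normSq_eq_norm_sq]
  have hPP : P * (P⁻¹ * P⁻¹ * ‖w‖ ^ 2) = P⁻¹ * ‖w‖ ^ 2 := by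
    rcases eq_or_ne P 0 with h | h
    · simp [h]
    · field_simp
  refine (Finset.sum_le_sum fun x _ => hle x).trans_eq ?_
  rw [Finset.sum_add_distrib, ← Finset.mul_sum, ← Finset.mul_sum]
  simp only [hdiv]
  rw [Finset.sum_add_distrib, Finset.sum_sub_distrib, ← Finset.mul_sum, ← Finset.sum_mul, hww]
  change _ + _ * (_ - _ + P * _) = _
  rw [hPP, div_eq_mul_inv (‖w‖ ^ 2)]
  ring

lemma IsCompact.convexHull_of_finiteDimensional {E : Type*} [AddCommGroup E] [Module ℝ E]
    [FiniteDimensional ℝ E] [TopologicalSpace E] [IsTopologicalAddGroup E] [ContinuousSMul ℝ E]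
    {s : Set E} (hs : IsCompact s) : IsCompact (convexHull ℝ s) := by
  let F : (n : ℕ) → (Fin n → ℝ) × (Fin n → E) → E := fun n q => ∑ i, q.1 i • q.2 i
  have hF : ∀ n, Continuous (F n) := fun n => by fun_prop
  have hcompact : IsCompact (⋃ n ∈ Finset.range (Module.finrank ℝ E + 2),
      F n '' (stdSimplex ℝ (Fin n) ×ˢ Set.univ.pi fun _ => s)) :=
    Finset.isCompact_biUnion _ fun n _ =>
      ((isCompact_stdSimplex ℝ (Fin n)).prod (isCompact_univ_pi fun _ => hs)).image (hF n)
  convert hcompact using 1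
  apply Set.Subset.antisymm
  · intro x hx
    obtain ⟨ι, _, z, w, hz, hind, hw, hw1, rfl⟩ := eq_pos_convex_span_of_mem_convexHull hx
    have hcard : Fintype.card ι ≤ Module.finrank ℝ E + 1 :=
      hind.card_le_finrank_succ.trans (Nat.succ_le_succ (Submodule.finrank_le _))
    let e := (Fintype.equivFin ι).symm
    refine Set.mem_biUnion (Finset.mem_coe.2 (Finset.mem_range.2 (Nat.lt_succ_of_le hcard)))
      ⟨(w ∘ e, z ∘ e), ⟨⟨fun i => (hw _).le, ?_⟩, fun i _ => hz ⟨_, rfl⟩⟩, ?_⟩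
    · rw [← hw1]
      exact e.sum_comp w
    · exact e.sum_comp fun i => w i • z i
  · refine Set.iUnion₂_subset fun n _ => ?_
    rintro _ ⟨⟨w, z⟩, ⟨⟨hw, hw1⟩, hz⟩, rfl⟩
    exact mem_convexHull_of_exists_fintype w z hw hw1 (fun i => hz i trivial) rfl

open scoped Pointwise in
lemma sum_mem_sum_smul {E X : Type*} [AddCommGroup E] [Module ℝ E] {K : Set E} (hK : Convex ℝ K)
    (hne : K.Nonempty) (t : Finset X) (m : X → ℝ) (S : X → E) (hm : ∀ x, 0 ≤ m x)
    (hS : ∀ x, S x ∈ m x • K) : ∑ x ∈ t, S x ∈ (∑ x ∈ t, m x) • K := by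
  classical
  induction t using Finset.induction_on with
  | empty => simp [Set.zero_smul_set hne]
  | insert x t hx ih =>
    rw [Finset.sum_insert hx, Finset.sum_insert hx,
      hK.add_smul (hm x) (Finset.sum_nonneg fun x _ => hm x)]
    exact Set.add_mem_add (hS x) ih

section ProductStates

open scoped Pointwise

variable {dA dB : ℕ} {VA VB : Type*} [AddCommGroup VA] [Module ℂ VA]
  [AddCommGroup VB] [Module ℂ VB]
  (ΦA : Matrix (Fin dA) (Fin dA) ℂ →ₗ[ℂ] VA) (ΨB : Matrix (Fin dB) (Fin dB) ℂ →ₗ[ℂ] VB)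
  (a : VA) (b : VB)

/-- The states obeying a linear constraint. -/
def constrainedStates {d : ℕ} {V : Type*} [AddCommGroup V] [Module ℂ V]
    (Φ : Matrix (Fin d) (Fin d) ℂ →ₗ[ℂ] V) (a : V) : Set (Matrix (Fin d) (Fin d) ℂ) :=
  {α | IsState α ∧ Φ α = a}

/-- The products of states obeying the local constraints. -/
def constrainedProducts : Set (Matrix (Fin dA × Fin dB) (Fin dA × Fin dB) ℂ) :=
  (fun q => Matrix.kroneckerMap (· * ·) q.1 q.2) ''
    (constrainedStates ΦA a ×ˢ constrainedStates ΨB b)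

lemma isCompact_constrainedStates {d : ℕ} {V : Type*} [AddCommGroup V] [Module ℂ V]
    (Φ : Matrix (Fin d) (Fin d) ℂ →ₗ[ℂ] V) (a : V) : IsCompact (constrainedStates Φ a) := by
  rcases (constrainedStates Φ a).eq_empty_or_nonempty with h | ⟨α₀, -, rfl⟩
  · rw [h]
    exact isCompact_empty
  have hbox : IsCompact (Set.univ.pi fun _ : Fin d => Set.univ.pi fun _ : Fin d =>
      Metric.closedBall (0 : ℂ) 1) :=
    isCompact_univ_pi fun _ => isCompact_univ_pi fun _ => isCompact_closedBall _ _
  refine hbox.of_isClosed_subset ?_ ?_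
  · have hset : constrainedStates Φ (Φ α₀) =
        ({α | αᴴ = α} ∩ ⋂ x : Fin d → ℂ, {α | 0 ≤ star x ⬝ᵥ (α *ᵥ x)}) ∩
          {α | α.trace = 1} ∩ (fun α => α - α₀) ⁻¹' (LinearMap.ker Φ : Set _) := by
      ext α
      simp [constrainedStates, IsState, Matrix.posSemidef_iff_dotProduct_mulVec,
        Matrix.IsHermitian, sub_eq_zero, and_assoc]
    rw [hset]
    refine ((IsClosed.inter ?_ (isClosed_iInter fun x => ?_)).inter ?_).inter ?_
    · exact isClosed_eq (Continuous.matrix_conjTranspose continuous_id) continuous_id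
    · exact isClosed_le continuous_const (by fun_prop)
    · exact isClosed_eq (by fun_prop) continuous_const
    · exact (Submodule.closed_of_finiteDimensional _).preimage (by fun_prop)
  · rintro α ⟨⟨hα, h1⟩, -⟩ i - j -
    simpa [h1] using hα.norm_apply_le_re_trace i j

lemma isCompact_constrainedProducts : IsCompact (constrainedProducts ΦA ΨB a b) :=
  ((isCompact_constrainedStates ΦA a).prod (isCompact_constrainedStates ΨB b)).image <|
    continuous_pi fun i => continuous_pi fun j => by
      simp only [Matrix.kroneckerMap_apply]
      fun_prop

lemma isClosed_convexHull_constrainedProducts :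
    IsClosed (convexHull ℝ (constrainedProducts ΦA ΨB a b)) :=
  (isCompact_constrainedProducts ΦA ΨB a b).convexHull_of_finiteDimensional.isClosed

lemma constrainedSep_of_mem_convexHull
    {ρ : Matrix (Fin dA × Fin dB) (Fin dA × Fin dB) ℂ}
    (hρ : ρ ∈ convexHull ℝ (constrainedProducts ΦA ΨB a b)) : ConstrainedSep ΦA ΨB a b ρ := by
  obtain ⟨ι, _, w, z, hw, hw1, hz, rfl⟩ := mem_convexHull_iff_exists_fintype.1 hρ
  choose q hq hqz using hz
  let e := (Fintype.equivFin ι).symm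
  refine ⟨Fintype.card ι, w ∘ e, fun l => (q (e l)).1, fun l => (q (e l)).2, fun l => hw _, ?_,
    fun l => ⟨(hq _).1.1, (hq _).2.1, (hq _).1.2, (hq _).2.2⟩, ?_⟩
  · rw [← hw1]
    exact e.sum_comp w
  · rw [← e.sum_comp]
    refine Finset.sum_congr rfl fun l _ => ?_
    rw [← hqz]
    exact (Complex.coe_smul _ _).symm

/-- Unnormalized bipartite states whose marginals obey the constraints. -/
structure IsFeasible (τ : Matrix (Fin dA × Fin dB) (Fin dA × Fin dB) ℂ) : Prop where
  posSemidef : τ.PosSemidef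
  left : ΦA (partialTraceRight τ) = τ.trace • a
  right : ΨB (partialTraceLeft τ) = τ.trace • b

variable {ΦA ΨB a b}

lemma IsFeasible.smul_mem_constrainedStates {τ : Matrix (Fin dA × Fin dB) (Fin dA × Fin dB) ℂ}
    (hτ : IsFeasible ΦA ΨB a b τ) (h0 : τ.trace ≠ 0) :
    τ.trace⁻¹ • partialTraceRight τ ∈ constrainedStates ΦA a ∧
      τ.trace⁻¹ • partialTraceLeft τ ∈ constrainedStates ΨB b := by
  have hinv : 0 ≤ τ.trace⁻¹ := inv_nonneg.2 hτ.posSemidef.trace_nonneg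
  refine ⟨⟨⟨(partialTraceRight_posSemidef hτ.posSemidef).smul hinv, ?_⟩, ?_⟩,
    ⟨⟨(partialTraceLeft_posSemidef hτ.posSemidef).smul hinv, ?_⟩, ?_⟩⟩
  · rw [Matrix.trace_smul, trace_partialTraceRight, smul_eq_mul, inv_mul_cancel₀ h0]
  · rw [map_smul, hτ.left, smul_smul, inv_mul_cancel₀ h0, one_smul]
  · rw [Matrix.trace_smul, trace_partialTraceLeft, smul_eq_mul, inv_mul_cancel₀ h0]
  · rw [map_smul, hτ.right, smul_smul, inv_mul_cancel₀ h0, one_smul]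

/-- The product of the marginals of a feasible operator, with the same trace. -/
lemma IsFeasible.exists_product {τ : Matrix (Fin dA × Fin dB) (Fin dA × Fin dB) ℂ}
    (hτ : IsFeasible ΦA ΨB a b τ) (hne : (constrainedProducts ΦA ΨB a b).Nonempty) :
    ∃ S ∈ τ.trace.re • convexHull ℝ (constrainedProducts ΦA ΨB a b), ∀ i j i' j',
      S (i, j) (i', j') =
        ((τ.trace.re⁻¹ : ℝ) : ℂ) * partialTraceRight τ i i' * partialTraceLeft τ j j' := by
  rcases eq_or_ne τ.trace.re 0 with h | h
  · exact ⟨0, by simp [h, Set.zero_smul_set hne.convexHull], by simp [h]⟩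
  · have h0 : τ.trace ≠ 0 := fun h' => h (by simp [h'])
    refine ⟨_, Set.smul_mem_smul_set (subset_convexHull ℝ _
      ⟨(_, _), hτ.smul_mem_constrainedStates h0, rfl⟩), fun i j i' j' => ?_⟩
    simp only [Matrix.smul_apply, Matrix.kroneckerMap_apply, Complex.real_smul,
      Complex.ofReal_inv, hτ.posSemidef.ofReal_re_trace, smul_eq_mul]
    field_simp

/-- `τ` satisfies `P`, and this persists through `k` rounds of measuring the effects given by `v`
on a copy of the first factor. -/
def Steerable {A J X : Type*} [Fintype A] [Fintype X] (v : X → A → ℂ)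
    (P : Matrix (A × J) (A × J) ℂ → Prop) : ℕ → Matrix (A × J) (A × J) ℂ → Prop
  | 0, τ => P τ
  | k + 1, τ => P τ ∧ ∃ T : X → Matrix (A × J) (A × J) ℂ,
      (∀ x, Steerable v P k (T x)) ∧ ∑ x, T x = τ ∧
        ∀ x, partialTraceLeft (T x) = condLeft (v x) τ

lemma Steerable.prop {A J X : Type*} [Fintype A] [Fintype X] {v : X → A → ℂ}
    {P : Matrix (A × J) (A × J) ℂ → Prop} {k : ℕ} {τ : Matrix (A × J) (A × J) ℂ}
    (h : Steerable v P k τ) : P τ := by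
  cases k with
  | zero => exact h
  | succ k => exact h.1

lemma norm_sub_product_le {X : Type*} [Fintype X] {v : X → Fin dA → ℂ}
    {c : Fin dA → Fin dA → X → ℂ} (hv : IsTomographic v c) {C : ℝ} (hC0 : 0 ≤ C)
    (hC : ∀ i j x, ‖c i j x‖ ≤ C) {δ : ℝ} (hδ : 0 < δ)
    {τ S : Matrix (Fin dA × Fin dB) (Fin dA × Fin dB) ℂ}
    {T : X → Matrix (Fin dA × Fin dB) (Fin dA × Fin dB) ℂ}
    (hTpos : ∀ x, (T x).PosSemidef) (hTsum : ∑ x, T x = τ)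
    (hT : ∀ x, partialTraceLeft (T x) = condLeft (v x) τ)
    (hS : ∀ i j i' j', S (i, j) (i', j') =
      ((τ.trace.re⁻¹ : ℝ) : ℂ) * partialTraceRight τ i i' * partialTraceLeft τ j j')
    (i i' : Fin dA) (j j' : Fin dB) :
    ‖τ (i, j) (i', j') - S (i, j) (i', j')‖ ≤
      C * (δ * τ.trace.re + δ⁻¹ * (∑ x, ‖partialTraceLeft (T x) j j'‖ ^ 2 / (T x).trace.re -
        ‖partialTraceLeft τ j j'‖ ^ 2 / τ.trace.re)) := by
  have hp : ∑ x, (T x).trace.re = τ.trace.re := by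
    rw [← hTsum, Matrix.trace_sum, Complex.re_sum]
  have hz : ∑ x, partialTraceLeft (T x) j j' = partialTraceLeft τ j j' := by
    simp only [← hTsum, partialTraceLeft, Matrix.of_apply, Matrix.sum_apply]
    exact Finset.sum_comm
  have hcS : ∀ x, condLeft (v x) S j j' =
      (((T x).trace.re * τ.trace.re⁻¹ : ℝ) : ℂ) * partialTraceLeft τ j j' := by
    intro x
    have h1 : (((T x).trace.re : ℝ) : ℂ) =
        ∑ y, ∑ y', star (v x y) * partialTraceRight τ y y' * v x y' := by
      rw [(hTpos x).ofReal_re_trace, ← trace_partialTraceLeft, hT]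
      simp only [Matrix.trace, Matrix.diag_apply, condLeft, partialTraceRight, Matrix.of_apply,
        Finset.mul_sum, Finset.sum_mul]
      rw [Finset.sum_comm]
      exact Finset.sum_congr rfl fun y _ => Finset.sum_comm
    rw [Complex.ofReal_mul, h1]
    simp only [condLeft, Matrix.of_apply, hS, Finset.sum_mul]
    exact Finset.sum_congr rfl fun y _ => Finset.sum_congr rfl fun y' _ => by ring
  have key := sum_norm_sub_le (fun x => partialTraceLeft (T x) j j') (fun x => (T x).trace.re)
    (fun x => (hTpos x).re_trace_nonneg) (fun x hx => by
      simp [(hTpos x).eq_zero_of_re_trace hx, partialTraceLeft]) hδ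
  simp only [hp, hz] at key
  refine le_trans ?_ (mul_le_mul_of_nonneg_left key hC0)
  rw [hv.apply_eq_sum τ, hv.apply_eq_sum S, ← Finset.sum_sub_distrib, Finset.mul_sum]
  refine (norm_sum_le _ _).trans (Finset.sum_le_sum fun x _ => ?_)
  rw [← mul_sub, norm_mul, hcS, hT]
  exact mul_le_mul_of_nonneg_right (hC i i' x) (norm_nonneg _)

lemma Steerable.exists_approx {X : Type*} [Fintype X] {v : X → Fin dA → ℂ}
    {c : Fin dA → Fin dA → X → ℂ} (hv : IsTomographic v c) {C : ℝ} (hC0 : 0 ≤ C)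
    (hC : ∀ i j x, ‖c i j x‖ ≤ C) {δ : ℝ} (hδ : 0 < δ)
    (hne : (constrainedProducts ΦA ΨB a b).Nonempty) (k : ℕ) :
    ∀ τ, Steerable v (IsFeasible ΦA ΨB a b) k τ →
      ∃ S ∈ ((k : ℝ) * τ.trace.re) • convexHull ℝ (constrainedProducts ΦA ΨB a b),
        ∀ i i' j j', ‖(k : ℂ) * τ (i, j) (i', j') - S (i, j) (i', j')‖ ≤
          C * (δ * (k * τ.trace.re) +
            δ⁻¹ * (τ.trace.re - ‖partialTraceLeft τ j j'‖ ^ 2 / τ.trace.re)) := by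
  induction k with
  | zero =>
    intro τ hτ
    refine ⟨0, by simp [Set.zero_smul_set hne.convexHull], fun i i' j j' => ?_⟩
    have hpos := hτ.prop.posSemidef
    have h1 := (partialTraceLeft_posSemidef hpos).norm_apply_le_re_trace j j'
    rw [trace_partialTraceLeft] at h1
    have h2 : ‖partialTraceLeft τ j j'‖ ^ 2 / τ.trace.re ≤ τ.trace.re :=
      div_le_of_le_mul₀ hpos.re_trace_nonneg hpos.re_trace_nonneg
        (by nlinarith [norm_nonneg (partialTraceLeft τ j j')])
    have h3 : 0 ≤ δ⁻¹ * (τ.trace.re - ‖partialTraceLeft τ j j'‖ ^ 2 / τ.trace.re) :=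
      mul_nonneg (inv_nonneg.2 hδ.le) (sub_nonneg.2 h2)
    simpa using mul_nonneg hC0 h3
  | succ k ih =>
    rintro τ ⟨hτ, T, hTs, hTsum, hT⟩
    obtain ⟨S₀, hS₀, hS₀'⟩ := hτ.exists_product hne
    choose S hS hS' using fun x => ih (T x) (hTs x)
    have hTpos := fun x => (hTs x).prop.posSemidef
    have hp : ∑ x, (T x).trace.re = τ.trace.re := by
      rw [← hTsum, Matrix.trace_sum, Complex.re_sum]
    have hconv := convex_convexHull ℝ (constrainedProducts ΦA ΨB a b)
    refine ⟨∑ x, S x + S₀, ?_, fun i i' j j' => ?_⟩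
    · rw [Nat.cast_succ, add_one_mul, hconv.add_smul
        (mul_nonneg k.cast_nonneg hτ.posSemidef.re_trace_nonneg) hτ.posSemidef.re_trace_nonneg]
      refine Set.add_mem_add ?_ hS₀
      rw [← hp, Finset.mul_sum]
      exact sum_mem_sum_smul hconv hne.convexHull _ _ _
        (fun x => mul_nonneg k.cast_nonneg (hTpos x).re_trace_nonneg) hS
    · have h0 := norm_sub_product_le hv hC0 hC hδ hTpos hTsum hT hS₀' i i' j j'
      have hsplit : ((k + 1 : ℕ) : ℂ) * τ (i, j) (i', j') - (∑ x, S x + S₀) (i, j) (i', j') =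
          ∑ x, ((k : ℂ) * T x (i, j) (i', j') - S x (i, j) (i', j')) +
            (τ (i, j) (i', j') - S₀ (i, j) (i', j')) := by
        rw [Finset.sum_sub_distrib, ← Finset.mul_sum, ← Matrix.sum_apply, ← Matrix.sum_apply,
          hTsum, Matrix.add_apply]
        push_cast
        ring
      rw [hsplit]
      refine (norm_add_le _ _).trans ((add_le_add ((norm_sum_le _ _).trans
        (Finset.sum_le_sum fun x _ => hS' x i i' j j')) h0).trans_eq ?_)
      rw [← Finset.mul_sum, Finset.sum_add_distrib, ← Finset.mul_sum, ← Finset.mul_sum,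
        ← Finset.mul_sum, Finset.sum_sub_distrib, hp]
      push_cast
      ring

end ProductStates

lemma Fin.sum_univ_fun_succ {α M : Type*} [Fintype α] [AddCommMonoid M] {n : ℕ}
    (F : (Fin (n + 1) → α) → M) : ∑ h, F h = ∑ x, ∑ g : Fin n → α, F (Fin.cons x g) := by
  rw [← (Fin.consEquiv fun _ => α).sum_comp, Fintype.sum_prod_type]
  rfl

section Extensions

variable {dA dB : ℕ} {VA VB : Type*} [AddCommGroup VA] [Module ℂ VA]
  [AddCommGroup VB] [Module ℂ VB]
  (ΦA : Matrix (Fin dA) (Fin dA) ℂ →ₗ[ℂ] VA) (ΨB : Matrix (Fin dB) (Fin dB) ℂ →ₗ[ℂ] VB)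
  (a : VA) (b : VB)

/-- Unnormalized permutation-invariant operators on `k + 1` copies of the first factor and one
copy of the second, obeying the linear constraints. -/
structure IsConstrainedSymmetric {k : ℕ} (R : Matrix ((Fin (k + 1) → Fin dA) × Fin dB)
    ((Fin (k + 1) → Fin dA) × Fin dB) ℂ) : Prop where
  posSemidef : R.PosSemidef
  symm : ∀ (σ : Equiv.Perm (Fin (k + 1))) (f g : Fin (k + 1) → Fin dA) (j j' : Fin dB),
    R (f ∘ σ, j) (g ∘ σ, j') = R (f, j) (g, j')
  right : ∀ f g : Fin (k + 1) → Fin dA,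
    ΨB (Matrix.of fun j j' => R (f, j) (g, j')) = (∑ j, R (f, j) (g, j)) • b
  left : ∀ g g' : Fin k → Fin dA,
    ΦA (Matrix.of fun x x' => ∑ j, R (Fin.cons x g, j) (Fin.cons x' g', j)) =
      (∑ x : Fin dA, ∑ j, R (Fin.cons x g, j) (Fin.cons x g', j)) • a

/-- The marginal on the first copy of the first factor and the second factor. -/
def firstMarginal {k : ℕ} (R : Matrix ((Fin (k + 1) → Fin dA) × Fin dB)
    ((Fin (k + 1) → Fin dA) × Fin dB) ℂ) : Matrix (Fin dA × Fin dB) (Fin dA × Fin dB) ℂ :=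
  Matrix.of fun p q => ∑ g : Fin k → Fin dA, R (Fin.cons p.1 g, p.2) (Fin.cons q.1 g, q.2)

/-- The unnormalized state left after the first copy of the first factor is found along `v`. -/
def condFirst {k : ℕ} (v : Fin dA → ℂ) (R : Matrix ((Fin (k + 1) → Fin dA) × Fin dB)
    ((Fin (k + 1) → Fin dA) × Fin dB) ℂ) :
    Matrix ((Fin k → Fin dA) × Fin dB) ((Fin k → Fin dA) × Fin dB) ℂ :=
  condLeft v (R.submatrix (fun p => (Fin.cons p.1 p.2.1, p.2.2))
    fun p => (Fin.cons p.1 p.2.1, p.2.2))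

lemma condFirst_apply {k : ℕ} (v : Fin dA → ℂ) (R : Matrix ((Fin (k + 1) → Fin dA) × Fin dB)
    ((Fin (k + 1) → Fin dA) × Fin dB) ℂ) (f g : Fin k → Fin dA) (j j' : Fin dB) :
    condFirst v R (f, j) (g, j') =
      ∑ x, ∑ x', (star (v x) * v x') * R (Fin.cons x f, j) (Fin.cons x' g, j') := by
  simp only [condFirst, condLeft, Matrix.of_apply, Matrix.submatrix_apply]
  exact Finset.sum_congr rfl fun x _ => Finset.sum_congr rfl fun x' _ => by ring

variable {ΦA ΨB a b}

lemma IsConstrainedSymmetric.isFeasible {k : ℕ} {R : Matrix ((Fin (k + 1) → Fin dA) × Fin dB)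
    ((Fin (k + 1) → Fin dA) × Fin dB) ℂ} (hR : IsConstrainedSymmetric ΦA ΨB a b R) :
    IsFeasible ΦA ΨB a b (firstMarginal R) where
  posSemidef := by
    have h : firstMarginal R = ∑ g : Fin k → Fin dA,
        R.submatrix (fun p : Fin dA × Fin dB => (Fin.cons p.1 g, p.2))
          fun p => (Fin.cons p.1 g, p.2) := by
      ext p q
      simp [firstMarginal, Matrix.sum_apply]
    rw [h]
    exact Matrix.posSemidef_sum _ fun g _ => hR.posSemidef.submatrix _
  left := by
    have h : partialTraceRight (firstMarginal R) = ∑ g : Fin k → Fin dA,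
        Matrix.of fun x x' => ∑ j, R (Fin.cons x g, j) (Fin.cons x' g, j) := by
      ext x x'
      simp only [partialTraceRight, firstMarginal, Matrix.of_apply, Matrix.sum_apply]
      exact Finset.sum_comm
    rw [← trace_partialTraceRight, h, map_sum, Matrix.trace_sum, Finset.sum_smul]
    exact Finset.sum_congr rfl fun g _ => hR.left g g
  right := by
    have h : partialTraceLeft (firstMarginal R) = ∑ f : Fin (k + 1) → Fin dA,
        Matrix.of fun j j' => R (f, j) (f, j') := by
      ext j j'
      simp only [partialTraceLeft, firstMarginal, Matrix.of_apply, Matrix.sum_apply,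
        Fin.sum_univ_fun_succ]
    rw [← trace_partialTraceLeft, h, map_sum, Matrix.trace_sum, Finset.sum_smul]
    exact Finset.sum_congr rfl fun f _ => hR.right f f

lemma IsConstrainedSymmetric.cons_cons_swap {k : ℕ}
    {R : Matrix ((Fin (k + 2) → Fin dA) × Fin dB) ((Fin (k + 2) → Fin dA) × Fin dB) ℂ}
    (hR : IsConstrainedSymmetric ΦA ΨB a b R) (x y x' y' : Fin dA) (f g : Fin k → Fin dA)
    (j j' : Fin dB) :
    R (Fin.cons x (Fin.cons y f : Fin (k + 1) → Fin dA), j)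
        (Fin.cons x' (Fin.cons y' g : Fin (k + 1) → Fin dA), j') =
      R (Fin.cons y (Fin.cons x f : Fin (k + 1) → Fin dA), j)
        (Fin.cons y' (Fin.cons x' g : Fin (k + 1) → Fin dA), j') := by
  have h : ∀ (x y : Fin dA) (f : Fin k → Fin dA),
      (Fin.cons x (Fin.cons y f : Fin (k + 1) → Fin dA) : Fin (k + 2) → Fin dA) =
        (Fin.cons y (Fin.cons x f : Fin (k + 1) → Fin dA) : Fin (k + 2) → Fin dA) ∘
          Equiv.swap 0 1 := by
    intro x y f
    funext i
    refine Fin.cases ?_ (fun i => Fin.cases ?_ (fun i => ?_) i) i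
    · simp
    · rw [Function.comp_apply, Fin.succ_zero_eq_one, Equiv.swap_apply_right, Fin.cons_zero,
        ← Fin.succ_zero_eq_one, Fin.cons_succ, Fin.cons_zero]
    · have h0 : i.succ.succ ≠ 0 := Fin.succ_ne_zero _
      have h1 : i.succ.succ ≠ 1 := by
        rw [← Fin.succ_zero_eq_one]
        exact fun h => Fin.succ_ne_zero _ (Fin.succ_injective _ h)
      simp [Equiv.swap_apply_of_ne_of_ne h0 h1]
  rw [h x y f, h x' y' g, hR.symm]

lemma IsConstrainedSymmetric.condFirst {k : ℕ}
    {R : Matrix ((Fin (k + 2) → Fin dA) × Fin dB) ((Fin (k + 2) → Fin dA) × Fin dB) ℂ}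
    (hR : IsConstrainedSymmetric ΦA ΨB a b R) (v : Fin dA → ℂ) :
    IsConstrainedSymmetric ΦA ΨB a b (condFirst v R) where
  posSemidef := condLeft_posSemidef v (hR.posSemidef.submatrix _)
  symm σ f g j j' := by
    have h : ∀ (x : Fin dA) (f : Fin (k + 1) → Fin dA),
        (Fin.cons x (f ∘ σ) : Fin (k + 2) → Fin dA) =
          (Fin.cons x f : Fin (k + 2) → Fin dA) ∘ Equiv.Perm.decomposeFin.symm (0, σ) := by
      intro x f
      funext i
      refine Fin.cases ?_ (fun i => ?_) i <;> simp
    simp only [condFirst_apply, h, hR.symm]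
  right f g := by
    have h : (Matrix.of fun j j' => _root_.condFirst v R (f, j) (g, j')) =
        ∑ x, ∑ x', (star (v x) * v x') •
          Matrix.of fun j j' => R (Fin.cons x f, j) (Fin.cons x' g, j') := by
      ext j j'
      simp [condFirst_apply, Matrix.sum_apply]
    have hs : ∑ j, _root_.condFirst v R (f, j) (g, j) =
        ∑ x, ∑ x', (star (v x) * v x') * ∑ j, R (Fin.cons x f, j) (Fin.cons x' g, j) := by
      simp only [condFirst_apply, Finset.mul_sum]
      rw [Finset.sum_comm]
      exact Finset.sum_congr rfl fun x _ => Finset.sum_comm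
    rw [h, hs]
    simp only [map_sum, map_smul, hR.right, Finset.sum_smul, mul_smul]
  left g g' := by
    have h : (Matrix.of fun y y' => ∑ j,
          _root_.condFirst v R (Fin.cons y g, j) (Fin.cons y' g', j)) =
        ∑ x, ∑ x', (star (v x) * v x') • Matrix.of fun y y' => ∑ j,
          R (Fin.cons y (Fin.cons x g : Fin (k + 1) → Fin dA), j)
            (Fin.cons y' (Fin.cons x' g' : Fin (k + 1) → Fin dA), j) := by
      ext y y'
      simp only [condFirst_apply, Matrix.sum_apply, Matrix.of_apply, Matrix.smul_apply,
        smul_eq_mul, Finset.mul_sum, hR.cons_cons_swap _ y]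
      rw [Finset.sum_comm]
      exact Finset.sum_congr rfl fun x _ => Finset.sum_comm
    have hs : ∑ y, ∑ j, _root_.condFirst v R (Fin.cons y g, j) (Fin.cons y g', j) =
        ∑ x, ∑ x', (star (v x) * v x') * ∑ y, ∑ j,
          R (Fin.cons y (Fin.cons x g : Fin (k + 1) → Fin dA), j)
            (Fin.cons y (Fin.cons x' g' : Fin (k + 1) → Fin dA), j) := by
      have := congrArg Matrix.trace h
      simp only [Matrix.trace_sum, Matrix.trace_smul, smul_eq_mul] at this
      exact this
    rw [h, hs]
    simp only [map_sum, map_smul, hR.left, Finset.sum_smul, mul_smul]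

lemma IsConstrainedSymmetric.steerable {X : Type*} [Fintype X] {v : X → Fin dA → ℂ}
    {c : Fin dA → Fin dA → X → ℂ} (hv : IsTomographic v c) (k : ℕ) :
    ∀ {R : Matrix ((Fin (k + 1) → Fin dA) × Fin dB) ((Fin (k + 1) → Fin dA) × Fin dB) ℂ},
      IsConstrainedSymmetric ΦA ΨB a b R →
        Steerable v (IsFeasible ΦA ΨB a b) k (firstMarginal R) := by
  induction k with
  | zero => exact fun hR => hR.isFeasible
  | succ k ih =>
    intro R hR
    refine ⟨hR.isFeasible, fun x => firstMarginal (_root_.condFirst (v x) R),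
      fun x => ih (hR.condFirst (v x)), ?_, fun x => ?_⟩
    · ext ⟨i, j⟩ ⟨i', j'⟩
      simp only [firstMarginal, Matrix.sum_apply, Matrix.of_apply, condFirst_apply,
        Fin.sum_univ_fun_succ (n := k)]
      rw [Finset.sum_comm, Finset.sum_comm (s := (Finset.univ : Finset (Fin dA)))]
      refine Finset.sum_congr rfl fun g _ => ?_
      rw [Finset.sum_comm]
      refine Finset.sum_congr rfl fun y _ => ?_
      rw [Finset.sum_comm]
      simp only [← Finset.sum_mul, hv.resolution, ite_mul, one_mul, zero_mul, Finset.sum_ite_eq,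
        Finset.mem_univ, if_true]
      exact hR.cons_cons_swap y i y i' g g j j'
    · ext j j'
      simp only [partialTraceLeft, firstMarginal, condLeft, Matrix.of_apply, condFirst_apply]
      rw [← Fin.sum_univ_fun_succ (fun h : Fin (k + 1) → Fin dA => ∑ y, ∑ y',
        (star (v x y) * v x y') * R (Fin.cons y h, j) (Fin.cons y' h, j')), Finset.sum_comm]
      refine Finset.sum_congr rfl fun y _ => ?_
      rw [Finset.sum_comm]
      refine Finset.sum_congr rfl fun y' _ => ?_
      rw [← Finset.mul_sum]
      ring

lemma mem_convexHull_of_forall_steerable {X : Type*} [Fintype X] {v : X → Fin dA → ℂ}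
    {c : Fin dA → Fin dA → X → ℂ} (hv : IsTomographic v c)
    {ρ : Matrix (Fin dA × Fin dB) (Fin dA × Fin dB) ℂ} (hρ : ρ.trace = 1)
    (h : ∀ k, Steerable v (IsFeasible ΦA ΨB a b) k ρ) :
    ρ ∈ convexHull ℝ (constrainedProducts ΦA ΨB a b) := by
  have hne : (constrainedProducts ΦA ΨB a b).Nonempty :=
    ⟨_, (_, _), (h 0).prop.smul_mem_constrainedStates (by simp [hρ]), rfl⟩
  obtain ⟨C, hC0, hC⟩ : ∃ C : ℝ, 0 ≤ C ∧ ∀ i j x, ‖c i j x‖ ≤ C :=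
    ⟨∑ i, ∑ j, ∑ x, ‖c i j x‖, by positivity, fun i j x =>
      (Finset.single_le_sum (f := fun x => ‖c i j x‖) (fun _ _ => by positivity)
        (Finset.mem_univ x)).trans <|
      (Finset.single_le_sum (f := fun j => ∑ x, ‖c i j x‖) (fun _ _ => by positivity)
        (Finset.mem_univ j)).trans <|
      Finset.single_le_sum (f := fun i => ∑ j, ∑ x, ‖c i j x‖) (fun _ _ => by positivity)
        (Finset.mem_univ i)⟩
  have happrox : ∀ n : ℕ, ∃ S ∈ convexHull ℝ (constrainedProducts ΦA ΨB a b),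
      ∀ i i' j j', ‖S (i, j) (i', j') - ρ (i, j) (i', j')‖ ≤ 2 * C * (1 / ((n : ℝ) + 1)) := by
    intro n
    obtain ⟨_, ⟨S, hS, rfl⟩, hS'⟩ := (h ((n + 1) ^ 2)).exists_approx hv hC0 hC
      (δ := 1 / ((n : ℝ) + 1)) (by positivity) hne
    refine ⟨S, hS, fun i i' j j' => ?_⟩
    have h1 := hS' i i' j j'
    simp only [hρ, Complex.one_re, mul_one, div_one, Matrix.smul_apply, Complex.real_smul] at h1
    rw [Complex.ofReal_natCast, ← mul_sub, norm_mul, Complex.norm_natCast, norm_sub_rev] at h1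
    push_cast at h1
    have hn : (0 : ℝ) < (n : ℝ) + 1 := by positivity
    have h2 : C * (1 / ((n : ℝ) + 1) * ((n : ℝ) + 1) ^ 2 +
        (1 / ((n : ℝ) + 1))⁻¹ * (1 - ‖partialTraceLeft ρ j j'‖ ^ 2)) ≤
          ((n : ℝ) + 1) ^ 2 * (2 * C * (1 / ((n : ℝ) + 1))) := by
      have h3 : ((n : ℝ) + 1) ^ 2 * (2 * C * (1 / ((n : ℝ) + 1))) = C * (2 * ((n : ℝ) + 1)) := by
        field_simp
      rw [h3]
      refine mul_le_mul_of_nonneg_left ?_ hC0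
      have h4 : 1 / ((n : ℝ) + 1) * ((n : ℝ) + 1) ^ 2 = (n : ℝ) + 1 := by field_simp
      rw [h4, one_div, inv_inv]
      nlinarith [mul_nonneg hn.le (sq_nonneg ‖partialTraceLeft ρ j j'‖)]
    exact le_of_mul_le_mul_left (h1.trans h2) (by positivity)
  choose S hS hS' using happrox
  refine (isClosed_convexHull_constrainedProducts ΦA ΨB a b).mem_of_tendsto
    (f := S) (b := Filter.atTop) ?_ (Filter.Eventually.of_forall hS)
  refine tendsto_pi_nhds.2 fun p => tendsto_pi_nhds.2 fun q => ?_
  rw [tendsto_iff_norm_sub_tendsto_zero]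
  refine squeeze_zero (fun _ => norm_nonneg _) (fun n => hS' n p.1 q.1 p.2 q.2) ?_
  simpa using (tendsto_one_div_add_atTop_nhds_zero_nat (𝕜 := ℝ)).const_mul (2 * C)

end Extensions

/-- The tensor power of a matrix. -/
def tensorPower {n : Type*} (α : Matrix n n ℂ) (k : ℕ) : Matrix (Fin k → n) (Fin k → n) ℂ :=
  Matrix.of fun f g => ∏ i, α (f i) (g i)

lemma tensorPower_posSemidef {n : Type*} [Fintype n] {α : Matrix n n ℂ} (hα : α.PosSemidef)
    (k : ℕ) : (tensorPower α k).PosSemidef := by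
  have h : ∀ s : Finset (Fin k), (Matrix.of fun f g : Fin k → n =>
      ∏ i ∈ s, α (f i) (g i)).PosSemidef := by
    intro s
    induction s using Finset.induction_on with
    | empty =>
      convert Matrix.posSemidef_vecMulVec_self_star (fun _ : Fin k → n => (1 : ℂ)) using 1
      ext f g
      simp [Matrix.vecMulVec_apply]
    | insert i s hi ih =>
      have h : (Matrix.of fun f g : Fin k → n => ∏ i ∈ insert i s, α (f i) (g i)) =
          Matrix.hadamard (α.submatrix (fun f : Fin k → n => f i) fun f => f i)
            (Matrix.of fun f g : Fin k → n => ∏ i ∈ s, α (f i) (g i)) := by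
        ext f g
        simp [Finset.prod_insert hi]
      rw [h]
      exact (hα.submatrix _).hadamard ih
  exact h Finset.univ

lemma trace_tensorPower {n : Type*} [Fintype n] (α : Matrix n n ℂ) (k : ℕ) :
    (tensorPower α k).trace = α.trace ^ k := by
  classical
  simp only [Matrix.trace, Matrix.diag_apply, tensorPower, Matrix.of_apply]
  rw [← Fintype.prod_sum fun (_ : Fin k) x => α x x, Finset.prod_const, Finset.card_univ,
    Fintype.card_fin]

lemma tensorPower_cons {n : Type*} (α : Matrix n n ℂ) (k : ℕ) (x x' : n) (f g : Fin k → n) :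
    tensorPower α (k + 1) (Fin.cons x f) (Fin.cons x' g) = α x x' * tensorPower α k f g := by
  simp [tensorPower, Fin.prod_univ_succ]

lemma tensorPower_comp_perm {n : Type*} (α : Matrix n n ℂ) (k : ℕ) (σ : Equiv.Perm (Fin k))
    (f g : Fin k → n) : tensorPower α k (f ∘ σ) (g ∘ σ) = tensorPower α k f g :=
  Equiv.prod_comp σ fun i => α (f i) (g i)

/-- A state `ρ_{AB}` is constrained separable with respect to
`(Φ_A, Ψ_B, a, b)` if and only if for every `k` it admits a `(k+1)`-constrained symmetric
extension: a state `ρ_k` on `(ℂ^{d_A})^{⊗(k+1)} ⊗ ℂ^{d_B}` that (1) reduces to `ρ_{AB}` after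
tracing out all but one `A`-factor, (2) is invariant under permutations of the `A`-factors,
(3) satisfies `(id ⊗ Ψ_B)(ρ_k) = Tr_B(ρ_k) ⊗ b`, and (4) satisfies
`(id ⊗ Φ_A)(Tr_B(ρ_k)) = Tr_{AB}(ρ_k) ⊗ a`. -/
theorem constrained_symmetric_extension_iff {dA dB : ℕ} {VA VB : Type*}
    [AddCommGroup VA] [Module ℂ VA] [FiniteDimensional ℂ VA]
    [AddCommGroup VB] [Module ℂ VB] [FiniteDimensional ℂ VB]
    (ΦA : Matrix (Fin dA) (Fin dA) ℂ →ₗ[ℂ] VA)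
    (ΨB : Matrix (Fin dB) (Fin dB) ℂ →ₗ[ℂ] VB)
    (a : VA) (b : VB)
    (ρ : Matrix (Fin dA × Fin dB) (Fin dA × Fin dB) ℂ) (hρ : IsState ρ) :
    ConstrainedSep ΦA ΨB a b ρ ↔
      ∀ k : ℕ,
        ∃ ρk : Matrix ((Fin (k + 1) → Fin dA) × Fin dB)
                      ((Fin (k + 1) → Fin dA) × Fin dB) ℂ,
          IsState ρk ∧
          (∀ (x x' : Fin dA) (bb bb' : Fin dB),
            ρ (x, bb) (x', bb') =
              ∑ g : Fin k → Fin dA, ρk (Fin.cons x g, bb) (Fin.cons x' g, bb')) ∧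
          (∀ (σ : Equiv.Perm (Fin (k + 1))) (f g : Fin (k + 1) → Fin dA)
              (bb bb' : Fin dB),
            ρk (f ∘ σ, bb) (g ∘ σ, bb') = ρk (f, bb) (g, bb')) ∧
          (∀ f g : Fin (k + 1) → Fin dA,
            ΨB (Matrix.of fun bb bb' => ρk (f, bb) (g, bb')) =
              (∑ bb : Fin dB, ρk (f, bb) (g, bb)) • b) ∧
          (∀ g g' : Fin k → Fin dA,
            ΦA (Matrix.of fun x x' =>
                ∑ bb : Fin dB, ρk (Fin.cons x g, bb) (Fin.cons x' g', bb)) =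
              (∑ x : Fin dA, ∑ bb : Fin dB,
                ρk (Fin.cons x g, bb) (Fin.cons x g', bb)) • a) := by
  constructor
  · rintro ⟨L, p, ρA, ρB, hp, hp1, hl, rfl⟩ k
    have htA : ∀ l, ∑ x, ρA l x x = 1 := fun l => (hl l).1.2
    have htB : ∀ l, ∑ j, ρB l j j = 1 := fun l => (hl l).2.1.2
    let R := ∑ l, (p l : ℂ) • Matrix.kroneckerMap (· * ·) (tensorPower (ρA l) (k + 1)) (ρB l)
    have hR : ∀ f g j j', R (f, j) (g, j') =
        ∑ l, (p l : ℂ) * (tensorPower (ρA l) (k + 1) f g * ρB l j j') := by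
      intro f g j j'
      simp [R, Matrix.sum_apply]
    refine ⟨R, ⟨?_, ?_⟩, ?_, ?_, ?_, ?_⟩
    · exact Matrix.posSemidef_sum _ fun l _ =>
        ((tensorPower_posSemidef (hl l).1.1 _).kronecker (hl l).2.1.1).smul
          (Complex.zero_le_real.2 (hp l))
    · simp only [R, Matrix.trace_sum, Matrix.trace_smul]
      have h1 : ∀ l, (Matrix.kroneckerMap (· * ·) (tensorPower (ρA l) (k + 1)) (ρB l)).trace =
          1 := fun l => by
        rw [Matrix.trace_kronecker, trace_tensorPower, (hl l).1.2, (hl l).2.1.2, one_pow, one_mul]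
      simp only [h1, smul_eq_mul, mul_one]
      exact_mod_cast hp1
    · intro x x' j j'
      simp only [hR, tensorPower_cons, Matrix.sum_apply, Matrix.smul_apply,
        Matrix.kroneckerMap_apply, smul_eq_mul]
      rw [Finset.sum_comm]
      refine Finset.sum_congr rfl fun l _ => ?_
      have h1 : ∑ g, tensorPower (ρA l) k g g = 1 := by
        have := trace_tensorPower (ρA l) k
        rwa [(hl l).1.2, one_pow] at this
      rw [← Finset.mul_sum, ← Finset.sum_mul, ← Finset.mul_sum, h1, mul_one]
    · intro σ f g j j'
      simp only [hR, tensorPower_comp_perm]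
    · intro f g
      have h1 : (Matrix.of fun j j' => R (f, j) (g, j')) =
          ∑ l, ((p l : ℂ) * tensorPower (ρA l) (k + 1) f g) • ρB l := by
        ext j j'
        simp [hR, Matrix.sum_apply, mul_assoc]
      have h2 : ∑ j, R (f, j) (g, j) = ∑ l, (p l : ℂ) * tensorPower (ρA l) (k + 1) f g := by
        simp only [hR]
        rw [Finset.sum_comm]
        exact Finset.sum_congr rfl fun l _ => by
          rw [← Finset.mul_sum, ← Finset.mul_sum, htB, mul_one]
      rw [h1, h2, map_sum, Finset.sum_smul]
      exact Finset.sum_congr rfl fun l _ => by rw [map_smul, (hl l).2.2.2]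
    · intro g g'
      have h0 : ∀ x x', ∑ j, R (Fin.cons x g, j) (Fin.cons x' g', j) =
          ∑ l, ((p l : ℂ) * tensorPower (ρA l) k g g') * ρA l x x' := by
        intro x x'
        simp only [hR, tensorPower_cons]
        rw [Finset.sum_comm]
        refine Finset.sum_congr rfl fun l _ => ?_
        rw [← Finset.mul_sum, ← Finset.mul_sum, htB]
        ring
      have h1 : (Matrix.of fun x x' => ∑ j, R (Fin.cons x g, j) (Fin.cons x' g', j)) =
          ∑ l, ((p l : ℂ) * tensorPower (ρA l) k g g') • ρA l := by
        ext x x'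
        simp [h0, Matrix.sum_apply]
      have h2 : ∑ x, ∑ j, R (Fin.cons x g, j) (Fin.cons x g', j) =
          ∑ l, (p l : ℂ) * tensorPower (ρA l) k g g' := by
        simp only [h0]
        rw [Finset.sum_comm]
        exact Finset.sum_congr rfl fun l _ => by rw [← Finset.mul_sum, htA, mul_one]
      rw [h1, h2, map_sum, Finset.sum_smul]
      exact Finset.sum_congr rfl fun l _ => by rw [map_smul, (hl l).2.2.1]
  · intro h
    have hne : Nonempty (Fin dA) := by
      by_contra hemp
      have := not_nonempty_iff.1 hemp
      simpa [Matrix.trace] using hρ.2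
    obtain ⟨X, _, v, c, hv⟩ := exists_isTomographic (Fin dA)
    refine constrainedSep_of_mem_convexHull ΦA ΨB a b
      (mem_convexHull_of_forall_steerable hv hρ.2 fun k => ?_)
    obtain ⟨R, hR, hmarg, hsymm, hright, hleft⟩ := h k
    have hRρ : firstMarginal R = ρ := by
      ext ⟨i, j⟩ ⟨i', j'⟩
      exact (hmarg i i' j j').symm
    exact hRρ ▸ IsConstrainedSymmetric.steerable hv k ⟨hR.1, hsymm, hright, hleft⟩
end
end
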